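/- Let n ≥ 1 and let k be an integer with k ≥ n² + 2n. For all derivations X₁, …, X_k ∈ Derivation ℂ A_n A_n, s_k(X₁, …, X_k) = 0 as a ℂ-linear endomorphism of A_n; that is, s_k = 0 is an identity on vector fields in n variables. -/

import Mathlib

noncomputable section

/-- Vector fields in `n` variables: `ℂ`-derivations of the polynomial ring `A_n`. -/
abbrev Vect (n : ℕ) : Type :=
  Derivation ℂ (MvPolynomial (Fin n) ℂ) (MvPolynomial (Fin n) ℂ)

/-- `s_k(T₁,…,T_k) = ∑_{σ} (sign σ) • T_{σ(k)} ∘ ⋯ ∘ T_{σ(1)}`, so that `T_{σ(1)}` acts first. -/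
def sEnd {A : Type*} [AddCommGroup A] [Module ℂ A] {k : ℕ}
    (T : Fin k → Module.End ℂ A) : Module.End ℂ A :=
  ∑ σ : Equiv.Perm (Fin k),
    (Equiv.Perm.sign σ : ℤ) • (List.ofFn fun i : Fin k => T (σ i)).reverse.prod

/-- The right-symmetric product `X ∘ᵣ Y` of vector fields: the unique derivation
sending each variable `xᵢ` to `Y (X xᵢ)`. -/
def rsym {n : ℕ} (X Y : Vect n) : Vect n :=
  MvPolynomial.mkDerivation ℂ fun i => Y (X (MvPolynomial.X i))

/-- Left-normed `rsym`-product of a list of vector fields. -/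
def leftNormProd {n : ℕ} : List (Vect n) → Vect n
  | [] => 0
  | a :: t => t.foldl rsym a

/-- `s_k^{rsym}(X₁,…,X_k)`: alternating sum of left-normed right-symmetric products. -/
def sRsym {n k : ℕ} (X : Fin k → Vect n) : Vect n :=
  ∑ σ : Equiv.Perm (Fin k),
    (Equiv.Perm.sign σ : ℤ) • leftNormProd (List.ofFn fun i : Fin k => X (σ i))

/-- Divergence of a vector field. -/
def divg {n : ℕ} (X : Vect n) : MvPolynomial (Fin n) ℂ :=
  ∑ i : Fin n, MvPolynomial.pderiv i (X (MvPolynomial.X i))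

end

open MvPolynomial in
/-- Sum of compositions as an alternating map. -/
noncomputable def sAlt (n k : ℕ) :
    AlternatingMap ℂ (Vect n) (Module.End ℂ (MvPolynomial (Fin n) ℂ)) (Fin k) :=
  MultilinearMap.alternatization
    (((MultilinearMap.mkPiAlgebraFin ℂ k
      (Module.End ℂ (MvPolynomial (Fin n) ℂ))).domDomCongr Fin.revPerm).compLinearMap
      (fun _ => ({ toFun := fun D => D.toLinearMap
                   map_add' := fun _ _ => rfl
                   map_smul' := fun _ _ => rfl } :
        Vect n →ₗ[ℂ] Module.End ℂ (MvPolynomial (Fin n) ℂ))))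

theorem reverse_ofFn_aux {α : Type*} {k : ℕ} (f : Fin k → α) :
    (List.ofFn f).reverse = List.ofFn fun i => f (Fin.rev i) := by
  apply List.ext_getElem
  · simp
  · intro i h1 h2
    simp only [List.getElem_reverse, List.getElem_ofFn, List.length_ofFn]
    congr 1
    ext
    simp only [Fin.val_rev]
    omega

theorem sAlt_apply (n k : ℕ) (X : Fin k → Vect n) :
    sAlt n k X = sEnd (fun i => (X i).toLinearMap) := by
  unfold sAlt sEnd
  rw [MultilinearMap.alternatization_apply]
  refine Finset.sum_congr rfl fun σ _ => ?_
  rw [reverse_ofFn_aux]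
  simp [MultilinearMap.domDomCongr_apply, Units.smul_def]

section filt

variable {n : ℕ} (I : Ideal (MvPolynomial (Fin n) ℂ))

theorem coeff_mem (J : Ideal (MvPolynomial (Fin n) ℂ)) (D : Vect n)
    (h : ∀ j, D (MvPolynomial.X j) ∈ J) (f : MvPolynomial (Fin n) ℂ) : D f ∈ J := by
  induction f using MvPolynomial.induction_on with
  | C a => simp
  | add p q hp hq => rw [map_add]; exact J.add_mem hp hq
  | mul_X p i hp =>
    rw [Derivation.leibniz]
    exact J.add_mem (J.mul_mem_left _ (h i)) (J.mul_mem_left _ hp)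

theorem pow_map (d : ℕ) (D : Vect n) (h : ∀ f, D f ∈ I ^ d) (r : ℕ)
    (f : MvPolynomial (Fin n) ℂ) (hf : f ∈ I ^ (r + 1)) : D f ∈ I ^ (r + d) := by
  induction r generalizing f with
  | zero => simpa using h f
  | succ r ih =>
    rw [pow_succ] at hf
    refine Submodule.mul_induction_on hf ?_ ?_
    · intro a ha b hb
      rw [Derivation.leibniz, smul_eq_mul, smul_eq_mul]
      refine Ideal.add_mem _ ?_ ?_
      · rw [pow_add]; exact Ideal.mul_mem_mul ha (h b)
      · have : I ^ (r + 1 + d) = I * I ^ (r + d) := by ring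
        rw [this]; exact Ideal.mul_mem_mul hb (ih a ha)
    · intro x y hx hy
      rw [map_add]; exact Ideal.add_mem _ hx hy

theorem weight_map (d : ℕ) (D : Vect n) (h : ∀ j, D (MvPolynomial.X j) ∈ I ^ d) (z w : ℤ)
    (hw : w = d - 1) (f : MvPolynomial (Fin n) ℂ) (hf : f ∈ I ^ z.toNat) :
    D.toLinearMap f ∈ I ^ (z + w).toNat := by
  have h' := coeff_mem (I ^ d) D h
  change D f ∈ _
  rcases le_or_gt z 0 with hz | hz
  · exact Ideal.pow_le_pow_right (by omega) (h' f)
  · obtain ⟨r, rfl⟩ : ∃ r : ℕ, z = r + 1 := ⟨(z - 1).toNat, by omega⟩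
    have e1 : ((r : ℤ) + 1).toNat = r + 1 := by omega
    have e2 : ((r : ℤ) + 1 + w).toNat = r + d := by omega
    rw [e1] at hf
    rw [e2]
    exact pow_map I d D h' r f hf

theorem list_map {k : ℕ} (T : Fin k → Module.End ℂ (MvPolynomial (Fin n) ℂ)) (w : Fin k → ℤ)
    (hT : ∀ i (z : ℤ) f, f ∈ I ^ z.toNat → T i f ∈ I ^ (z + w i).toNat) (z : ℤ)
    (f : MvPolynomial (Fin n) ℂ) (hf : f ∈ I ^ z.toNat) :
    (List.ofFn T).reverse.prod f ∈ I ^ (z + ∑ i, w i).toNat := by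
  induction k generalizing z f with
  | zero => simpa using hf
  | succ k ih =>
    rw [List.ofFn_succ, List.reverse_cons, List.prod_append, List.prod_singleton,
      Module.End.mul_apply, Fin.sum_univ_succ, ← add_assoc]
    exact ih (fun i => T i.succ) (fun i => w i.succ) (fun i => hT i.succ) _ _ (hT 0 z f hf)

theorem sEnd_mem {k : ℕ} (T : Fin k → Module.End ℂ (MvPolynomial (Fin n) ℂ)) (w : Fin k → ℤ)
    (hT : ∀ i (z : ℤ) f, f ∈ I ^ z.toNat → T i f ∈ I ^ (z + w i).toNat) (z : ℤ)
    (f : MvPolynomial (Fin n) ℂ) (hf : f ∈ I ^ z.toNat) :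
    sEnd T f ∈ I ^ (z + ∑ i, w i).toNat := by
  unfold sEnd
  rw [LinearMap.sum_apply]
  refine Ideal.sum_mem _ fun σ _ => ?_
  rw [LinearMap.smul_apply]
  refine zsmul_mem ?_ _
  rw [← Equiv.sum_comp σ w]
  exact list_map I (fun i => T (σ i)) (fun i => w (σ i)) (fun i => hT (σ i)) z f hf

end filt

theorem sEnd_C {n k : ℕ} (hk : 1 ≤ k) (X : Fin k → Vect n) (c : ℂ) :
    sEnd (fun i => (X i).toLinearMap) (MvPolynomial.C c) = 0 := by
  obtain ⟨k, rfl⟩ : ∃ m, k = m + 1 := ⟨k - 1, by omega⟩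
  unfold sEnd
  rw [LinearMap.sum_apply]
  refine Finset.sum_eq_zero fun σ _ => ?_
  rw [LinearMap.smul_apply, List.ofFn_succ, List.reverse_cons, List.prod_append,
    List.prod_singleton, Module.End.mul_apply]
  have : (X (σ 0)).toLinearMap (MvPolynomial.C c) = 0 := MvPolynomial.derivation_C (X (σ 0)) c
  rw [this, map_zero, smul_zero]

section taylor

open MvPolynomial

variable {n : ℕ} (p : Fin n → ℂ)

/-- The maximal ideal at `p`. -/
noncomputable def mIdeal : Ideal (MvPolynomial (Fin n) ℂ) :=
  RingHom.ker (eval p)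

theorem lin_mem (l : Fin n) : (X l - C (p l) : MvPolynomial (Fin n) ℂ) ∈ mIdeal p := by
  simp [mIdeal, RingHom.mem_ker]

theorem taylor (u : MvPolynomial (Fin n) ℂ) : ∃ (a : ℂ) (b : Fin n → ℂ),
    u - C a - ∑ l, C (b l) * (X l - C (p l)) ∈ mIdeal p ^ 2 := by
  induction u using MvPolynomial.induction_on with
  | C a => exact ⟨a, 0, by simp⟩
  | add u v hu hv =>
    obtain ⟨a, b, h⟩ := hu
    obtain ⟨a', b', h'⟩ := hv
    refine ⟨a + a', b + b', ?_⟩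
    convert Ideal.add_mem _ h h' using 1
    simp only [map_add, Pi.add_apply, add_mul, Finset.sum_add_distrib]
    ring
  | mul_X u i hu =>
    obtain ⟨a, b, h⟩ := hu
    refine ⟨a * p i, fun l => b l * p i + (if l = i then a else 0), ?_⟩
    have hL : (∑ l, C (b l) * (X l - C (p l)) : MvPolynomial (Fin n) ℂ) ∈ mIdeal p :=
      Ideal.sum_mem _ fun l _ => Ideal.mul_mem_left _ _ (lin_mem p l)
    have h2 := Ideal.mul_mem_mul hL (lin_mem p i)
    rw [← pow_two] at h2
    convert Ideal.add_mem _ (Ideal.mul_mem_right (X i) _ h) h2 using 1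
    have : (∑ l, C (b l * p i + (if l = i then a else 0)) * (X l - C (p l)) :
        MvPolynomial (Fin n) ℂ)
        = (∑ l, C (b l) * (X l - C (p l))) * C (p i) + C a * (X i - C (p i)) := by
      simp only [map_add, add_mul, Finset.sum_add_distrib, Finset.sum_mul]
      congr 1
      · refine Finset.sum_congr rfl fun l _ => ?_
        rw [C_mul]; ring
      · rw [Finset.sum_eq_single i] <;> simp +contextual
    rw [this, C_mul]
    ring

/-- Low order vector fields. -/
noncomputable def lowE : Fin n ⊕ Fin n × Fin n → Vect n
  | Sum.inl j => pderiv j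
  | Sum.inr (j, l) => (X l - C (p l) : MvPolynomial (Fin n) ℂ) • pderiv j

theorem der_sum {ι : Type*} (s : Finset ι) (D : ι → Vect n) (f : MvPolynomial (Fin n) ℂ) :
    (∑ i ∈ s, D i) f = ∑ i ∈ s, D i f := by
  classical
  induction s using Finset.induction_on with
  | empty => simp
  | insert a s ha ih => rw [Finset.sum_insert ha, Finset.sum_insert ha, Derivation.add_apply, ih]

theorem decomp (D : Vect n) : ∃ (a : Fin n ⊕ Fin n × Fin n → ℂ) (R : Vect n),
    (∀ j, R (X j) ∈ mIdeal p ^ 2) ∧ D = R + ∑ c, a c • lowE p c := by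
  choose a b h using fun j => taylor p (D (X j))
  refine ⟨Sum.elim a (fun q => b q.1 q.2),
    D - ∑ c, (Sum.elim a (fun q => b q.1 q.2) : _ → ℂ) c • lowE p c, ?_, by simp⟩
  intro j
  convert h j using 1
  simp only [Derivation.sub_apply, der_sum, Derivation.add_apply, Derivation.smul_apply,
    Fintype.sum_sum_type, Fintype.sum_prod_type, Sum.elim_inl, Sum.elim_inr, lowE, pderiv_X]
  rw [← sub_sub]
  congr 1
  · congr 1
    rw [Finset.sum_eq_single j]
    · simp [smul_eq_C_mul]
    · intro i _ hi
      simp [Pi.single_apply, hi.symm]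
    · simp
  · rw [Finset.sum_eq_single j]
    · simp [smul_eq_C_mul]
    · intro i _ hi
      simp [Pi.single_apply, hi.symm]
    · simp

end taylor

/-- Weights. -/
def wt {n : ℕ} : Option (Fin n ⊕ Fin n × Fin n) → ℕ
  | none => 2
  | some (Sum.inl _) => 0
  | some (Sum.inr _) => 1

theorem count {n k : ℕ} (hk : n ^ 2 + 2 * n ≤ k) (r : Fin k → Option (Fin n ⊕ Fin n × Fin n))
    (hr : ∀ i j, r i = r j → r i ≠ none → i = j) :
    0 ≤ ∑ i, ((wt (r i) : ℤ) - 1) := by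
  classical
  let g : Option (Fin n ⊕ Fin n × Fin n) → ℤ := fun c => 2 - wt c
  have hg : ∀ c, 0 ≤ g c := by
    rintro (_ | _ | _) <;> simp [g, wt]
  have h1 : ∑ i, g (r i) ≤ ∑ c, g c := by
    have : ∑ i, g (r i) = ∑ i ∈ Finset.univ.filter (fun i => r i ≠ none), g (r i) := by
      rw [Finset.sum_filter]
      refine Finset.sum_congr rfl fun i _ => ?_
      split_ifs with h
      · rfl
      · rw [not_not.1 h]; simp [g, wt]
    rw [this, ← Finset.sum_image (g := r) (f := g)]
    · exact Finset.sum_le_sum_of_subset_of_nonneg (Finset.subset_univ _) fun c _ _ => hg c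
    · intro i hi j _ hij
      exact hr i j hij (by simpa using hi)
  have h2 : ∑ c, g c = n ^ 2 + 2 * n := by
    rw [Fintype.sum_option, Fintype.sum_sum_type]
    simp [g, wt]; ring
  have h3 : ∑ i, ((wt (r i) : ℤ) - 1) = k - ∑ i, g (r i) := by
    rw [eq_sub_iff_add_eq, ← Finset.sum_add_distrib]
    simp [g]
  have : ((n ^ 2 + 2 * n : ℕ) : ℤ) ≤ k := by exact_mod_cast hk
  push_cast at this
  linarith

theorem main_eval {n k : ℕ} (hk : n ^ 2 + 2 * n ≤ k) (X : Fin k → Vect n) (p : Fin n → ℂ)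
    (f : MvPolynomial (Fin n) ℂ) (hf : f ∈ mIdeal p) : sAlt n k X f ∈ mIdeal p := by
  classical
  choose a R hR hX using fun i => decomp p (X i)
  let A : Fin k → Option (Fin n ⊕ Fin n × Fin n) → ℂ := fun i c => c.elim 1 (a i)
  let E : Fin k → Option (Fin n ⊕ Fin n × Fin n) → Vect n := fun i c => c.elim (R i) (lowE p)
  have hX' : X = fun i => ∑ c, A i c • E i c := by
    funext i
    rw [Fintype.sum_option]
    simpa [A, E] using hX i
  have key : sAlt n k X = ∑ r : Fin k → Option (Fin n ⊕ Fin n × Fin n),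
      (∏ i, A i (r i)) • sAlt n k (fun i => E i (r i)) := by
    rw [hX']
    have := (sAlt n k).toMultilinearMap.map_sum (fun i c => A i c • E i c)
    refine this.trans (Finset.sum_congr rfl fun r _ => ?_)
    exact (sAlt n k).toMultilinearMap.map_smul_univ (fun i => A i (r i)) (fun i => E i (r i))
  rw [key, LinearMap.sum_apply]
  refine Ideal.sum_mem _ fun r _ => ?_
  rw [LinearMap.smul_apply, MvPolynomial.smul_eq_C_mul]
  refine Ideal.mul_mem_left _ _ ?_
  by_cases hr : ∀ i j, r i = r j → r i ≠ none → i = j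
  · rw [sAlt_apply]
    have hc := count hk r hr
    have := sEnd_mem (mIdeal p) (fun i => (E i (r i)).toLinearMap)
      (fun i => (wt (r i) : ℤ) - 1) (fun i z f hf =>
        weight_map (mIdeal p) (wt (r i)) (E i (r i)) ?_ z _ rfl f hf) 1 f (by simpa using hf)
    · refine Ideal.pow_le_self ?_ this
      omega
    · intro j
      rcases hri : r i with _ | c | ⟨c, l⟩
      · exact hR i j
      · simp [wt]
      · simp only [E, Option.elim, lowE, wt, pow_one, Derivation.smul_apply, smul_eq_mul]
        exact Ideal.mul_mem_right _ _ (lin_mem p l)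
  · push Not at hr
    obtain ⟨i, j, hij, hne, hd⟩ := hr
    have : sAlt n k (fun i => E i (r i)) = 0 := by
      refine (sAlt n k).map_eq_zero_of_eq _ (i := i) (j := j) ?_ hd
      obtain ⟨c, hc⟩ := Option.ne_none_iff_exists'.1 hne
      simp [← hij, hc, E]
    rw [this]
    simp

/-- for `k ≥ n² + 2n`, `s_k = 0` is an identity on `Vect(n)`. -/
theorem stmt_1 (n k : ℕ) (hn : 1 ≤ n) (hk : n ^ 2 + 2 * n ≤ k)
    (X : Fin k → Vect n) :
    sEnd (fun i => (X i).toLinearMap) = 0 := by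
  refine LinearMap.ext fun f => MvPolynomial.funext fun p => ?_
  have hk1 : 1 ≤ k := by nlinarith
  have h1 : f - MvPolynomial.C (MvPolynomial.eval p f) ∈ mIdeal p := by
    simp [mIdeal, RingHom.mem_ker]
  have h2 := main_eval hk X p _ h1
  rw [sAlt_apply, map_sub, sEnd_C hk1, sub_zero] at h2
  simpa [mIdeal, RingHom.mem_ker] using h2
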